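/- For every integer n ≥ 1, the function t ↦ t^(−3n−3)·(t^(2n)(1+t²+t⁴)+t³−t²−1)/(1+t) tends to (−1)^n·(6n+1) as t tends to −1 within ℂ \ {−1}. Consequently, the value J_n(−1) of the Jones polynomial of K_n at t = −1 equals (−1)^n·(6n+1), and in particular J_n(−1) ≠ 1 for all n ≥ 1. -/

import Mathlib

/-- The numerator in the formula for the Jones polynomial of `K_n` has derivative `-(6n+1)` at `-1`. -/
theorem hasDerivAt_jones_numerator (n : ℕ) :
    HasDerivAt (fun t : ℂ => t ^ (2 * n) * (1 + t ^ 2 + t ^ 4) + t ^ 3 - t ^ 2 - 1)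
      (-(6 * (n : ℂ) + 1)) (-1) := by
  have hpow (k : ℕ) := hasDerivAt_pow k (-1 : ℂ)
  have hpow_two_mul : HasDerivAt (fun t : ℂ => t ^ (2 * n)) (-(2 * (n : ℂ))) (-1) := by
    simpa [pow_mul, mul_comm (2 : ℂ)] using (hasDerivAt_pow 2 (-1 : ℂ)).fun_pow n
  refine ((((hpow_two_mul.fun_mul (((hpow 2).const_add 1).fun_add (hpow 4))).fun_add
    (hpow 3)).fun_sub (hpow 2)).sub_const 1).congr_deriv ?_
  rw [pow_mul]
  norm_num
  ring

/-- For every `n ≥ 1`, the function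
`t ↦ t^(−3n−3)·(t^(2n)(1+t²+t⁴)+t³−t²−1)/(1+t)` tends to `(−1)^n·(6n+1)` as
`t → −1` within `ℂ \ {−1}`; consequently this limit value `J_n(−1)` is never `1`. -/
theorem stmt7 (n : ℕ) (hn : 1 ≤ n) :
    Filter.Tendsto
      (fun t : ℂ => t ^ (-3 * (n : ℤ) - 3) *
        ((t ^ (2 * n) * (1 + t ^ 2 + t ^ 4) + t ^ 3 - t ^ 2 - 1) / (1 + t)))
      (nhdsWithin (-1) {(-1 : ℂ)}ᶜ)
      (nhds ((-1) ^ n * (6 * (n : ℂ) + 1))) ∧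
    ((-1 : ℂ)) ^ n * (6 * (n : ℂ) + 1) ≠ 1 := by
  constructor
  · have hquot := hasDerivAt_iff_tendsto_slope.1 (hasDerivAt_jones_numerator n)
    have hzpow : Filter.Tendsto (fun t : ℂ => t ^ (-3 * (n : ℤ) - 3))
        (nhdsWithin (-1) {(-1 : ℂ)}ᶜ) (nhds ((-1) ^ (-3 * (n : ℤ) - 3))) :=
      (continuousAt_zpow₀ (-1 : ℂ) _ (Or.inl (by norm_num))).tendsto.mono_left
        nhdsWithin_le_nhds
    have hsign : (-1 : ℂ) ^ (-3 * (n : ℤ) - 3) = -(-1) ^ n := by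
      rw [show -3 * (n : ℤ) - 3 = n + 1 + 2 * (-2 * n - 2) by ring,
        zpow_add₀ (by norm_num), zpow_add₀ (by norm_num), zpow_mul]
      simp
    convert hzpow.mul hquot using 2 with t
    · rw [slope_def_field, pow_mul (-1 : ℂ)]
      norm_num [add_comm]
    · rw [hsign]
      ring
  · intro h
    have hint : (-1 : ℤ) ^ n * (6 * n + 1) = 1 := by exact_mod_cast h
    rcases neg_one_pow_eq_or ℤ n with hs | hs <;> rw [hs] at hint <;> omega
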